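/- Let X be at the same time a simplicial complex and an n-PCM with n ≥ 1. Then for every h ∈ ΔX: (1) α□_X(h) ⊆ ΔX (so ΔX is closed under inclusion of simplices), and (2) Δ(β□_X(h)) ⊆ ΔX, where Δ(β□_X(h)) is the border of the subposet β□_X(h). -/

import Mathlib

namespace PCMPaper

variable {α : Type*} [PartialOrder α]

/-- The set of elements of `X` strictly below `h` (α□_X(h)). -/
def alphaS (X : Set α) (h : α) : Set α := {x ∈ X | x < h}

/-- The set of elements of `X` strictly above `h` (β□_X(h)). -/
def betaS (X : Set α) (h : α) : Set α := {x ∈ X | h < x}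

/-- The (strict) neighborhood θ□_X(h) = α□_X(h) ∪ β□_X(h). -/
def thetaS (X : Set α) (h : α) : Set α := alphaS X h ∪ betaS X h

/-- The rank of `h` in the poset `X`: the maximal length of a strictly increasing
chain in `X` ending at `h`.  (It equals 0 when α□_X(h) = ∅ and
`max_{x ∈ α□_X(h)} rank X x + 1` otherwise, for finite `X`.) -/
noncomputable def rank (X : Set α) (h : α) : ℕ :=
  sSup {n : ℕ | ∃ c : Fin (n + 1) → α, StrictMono c ∧ (∀ i, c i ∈ X) ∧ c (Fin.last n) = h}

open scoped Classical in
/-- The rank of the poset `X`: maximal rank of its elements, `-1` if empty. -/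
noncomputable def rankSet (X : Set α) : ℤ :=
  if X = ∅ then -1 else ((sSup (rank X '' X) : ℕ) : ℤ)

/-- One step of a path in `X`: two distinct comparable elements of `X`. -/
def rel (X : Set α) (x y : α) : Prop :=
  x ∈ X ∧ y ∈ X ∧ x ≠ y ∧ (x < y ∨ y < x)

/-- `X` is (path-)connected: any two elements are joined by a path in `X`. -/
def IsConnected (X : Set α) : Prop :=
  ∀ x ∈ X, ∀ y ∈ X, Relation.ReflTransGen (rel X) x y

/-- `IsSurfaceAux (k + 1) X` means that `X` is a (discrete) `k`-surface. -/
def IsSurfaceAux : ℕ → Set α → Prop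
  | 0, X => X = ∅
  | 1, X => ∃ x y : α, x ≠ y ∧ ¬ x < y ∧ ¬ y < x ∧ X = {x, y}
  | (n + 2), X => X.Nonempty ∧ IsConnected X ∧ ∀ h ∈ X, IsSurfaceAux (n + 1) (thetaS X h)

/-- `X` is a discrete `k`-surface (`k : ℤ`, `k ≥ -1`). -/
def IsSurface (k : ℤ) (X : Set α) : Prop :=
  ∃ n : ℕ, (n : ℤ) = k + 1 ∧ IsSurfaceAux n X

/-- The border ΔX of a poset `X` of rank `n`:
elements whose neighborhood is not an `(n-1)`-surface. -/
def border (X : Set α) : Set α :=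
  {h ∈ X | ¬ IsSurface (rankSet X - 1) (thetaS X h)}

/-- The interior of `X`. -/
def interior' (X : Set α) : Set α := X \ border X

/-- `IsPCMAux (n + 1) X` means that `X` is an `n`-PCM. -/
def IsPCMAux : ℕ → Set α → Prop
  | 0, X => X = ∅
  | 1, X => ∃ x : α, X = {x}
  | (n + 2), X => rankSet X = ((n : ℤ) + 1) ∧ IsConnected X ∧ border X ≠ ∅ ∧
      ∀ h ∈ X, (h ∈ border X → IsPCMAux (n + 1) (thetaS X h)) ∧
               (h ∉ border X → IsSurfaceAux (n + 1) (thetaS X h))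

/-- `X` is an `k`-PCM (`k : ℤ`, `k ≥ -1`). -/
def IsPCM (k : ℤ) (X : Set α) : Prop :=
  ∃ n : ℕ, (n : ℤ) = k + 1 ∧ IsPCMAux n X

/-- Fuel-indexed coherence. -/
def IsCoherentAux : ℕ → Set α → Prop
  | 0, X => X = ∅
  | (n + 1), X => X = ∅ ∨
      ∀ h ∈ X, rankSet (thetaS X h) = rankSet X - 1 ∧ IsCoherentAux n (thetaS X h)

/-- `X` is a coherent poset. -/
def IsCoherent (X : Set α) : Prop := ∃ n : ℕ, IsCoherentAux n X

/-- `X` is a separated union of `(m-1)`-surfaces: a union of `(m-1)`-surfaces such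
that no element of one of them is comparable to an element of another one. -/
def IsSeparatedUnionOfSurfacesAux (m : ℕ) (X : Set α) : Prop :=
  ∃ P : Set (Set α), P.Nonempty ∧ X = ⋃₀ P ∧ (∀ S ∈ P, IsSurfaceAux m S) ∧
    ∀ S ∈ P, ∀ T ∈ P, S ≠ T → ∀ x ∈ S, ∀ y ∈ T, ¬ x ≤ y ∧ ¬ y ≤ x

/-- `IsSmoothPCMAux (n + 1) X` means that `X` is a smooth `n`-PCM. -/
def IsSmoothPCMAux : ℕ → Set α → Prop
  | 0, X => X = ∅
  | 1, X => ∃ x : α, X = {x}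
  | (n + 2), X => rankSet X = ((n : ℤ) + 1) ∧ IsConnected X ∧ border X ≠ ∅ ∧
      IsSeparatedUnionOfSurfacesAux (n + 1) (border X) ∧
      ∀ h ∈ X, IsSurfaceAux (n + 1) (thetaS X h) ∨ IsSmoothPCMAux (n + 1) (thetaS X h)

/-- `X` is a smooth `k`-PCM (`k : ℤ`, `k ≥ -1`). -/
def IsSmoothPCM (k : ℤ) (X : Set α) : Prop :=
  ∃ n : ℕ, (n : ℤ) = k + 1 ∧ IsSmoothPCMAux n X

/-- A simplicial complex: a finite family of nonempty finite sets, closed under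
taking nonempty subsets and under nonempty intersections. -/
def IsSimplicialComplex {V : Type*} [DecidableEq V] (X : Set (Finset V)) : Prop :=
  X.Finite ∧ (∀ h ∈ X, h.Nonempty) ∧
  (∀ h ∈ X, ∀ h' : Finset V, h'.Nonempty → h' ⊆ h → h' ∈ X) ∧
  (∀ h ∈ X, ∀ h' ∈ X, (h ∩ h').Nonempty → h ∩ h' ∈ X)

/-- The dimension of a simplex. -/
def dim {V : Type*} (h : Finset V) : ℤ := (h.card : ℤ) - 1

/-- The link of a simplex `h` in a family of simplices `S`. -/
def link {V : Type*} [DecidableEq V] (h : Finset V) (S : Set (Finset V)) : Set (Finset V) :=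
  {h' ∈ S | h ∩ h' = ∅ ∧ h ∪ h' ∈ S}

/-- `X` is pure of rank `n`: every simplex is contained in an `n`-dimensional one. -/
def Pure {V : Type*} (X : Set (Finset V)) (n : ℤ) : Prop :=
  ∀ h ∈ X, ∃ g ∈ X, h ⊆ g ∧ dim g = n

/-- Any two `n`-simplices of `X` are joined by a path in `X` all of whose elements
are simplices of dimension `n - 1` or `n` (i.e. `X` is `(n-1)`-connected). -/
def NConnected {V : Type*} (X : Set (Finset V)) (n : ℤ) : Prop :=
  ∀ a ∈ X, dim a = n → ∀ b ∈ X, dim b = n →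
    Relation.ReflTransGen (rel {h | h ∈ X ∧ (dim h = n - 1 ∨ dim h = n)}) a b

/-- `X` is a pseudomanifold of rank `n`. -/
def IsPseudomanifold {V : Type*} [DecidableEq V] (X : Set (Finset V)) (n : ℤ) : Prop :=
  IsSimplicialComplex X ∧ rankSet X = n ∧
  ((n = 0 ∧ ∃ v : V, X = {({v} : Finset V)}) ∨
   (1 ≤ n ∧ Pure X n ∧
    (∀ h ∈ X, dim h = n - 1 →
      Set.ncard {g | g ∈ X ∧ h ⊆ g ∧ dim g = n} ∈ ({1, 2} : Set ℕ)) ∧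
    NConnected X n))

/-- `X` is a normal pseudomanifold of rank `n`: a pseudomanifold such that the link
of every simplex of dimension at most `n - 2` is a pseudomanifold. -/
def IsNormalPseudomanifold {V : Type*} [DecidableEq V] (X : Set (Finset V)) (n : ℤ) : Prop :=
  IsPseudomanifold X n ∧
  ∀ h ∈ X, dim h ≤ n - 2 → IsPseudomanifold (link h X) (n - dim h - 1)

theorem IsSurfaceAux.nonempty {n : ℕ} {X : Set α} (hX : IsSurfaceAux (n + 1) X) : X.Nonempty := by
  cases n with
  | zero =>
    obtain ⟨x, y, -, -, -, rfl⟩ := hX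
    exact ⟨x, by simp⟩
  | succ n => exact hX.1

theorem isSurfaceAux_empty_iff {n : ℕ} : IsSurfaceAux n (∅ : Set α) ↔ n = 0 := by
  cases n with
  | zero => simp [IsSurfaceAux]
  | succ n => exact ⟨fun h => absurd h.nonempty Set.not_nonempty_empty, fun h => by omega⟩

theorem IsSurfaceAux.thetaS {n : ℕ} {X : Set α} (hX : IsSurfaceAux (n + 1) X) {x : α}
    (hx : x ∈ X) : IsSurfaceAux n (thetaS X x) := by
  cases n with
  | zero =>
    obtain ⟨a, b, -, hab, hba, rfl⟩ := hX
    change _ = ∅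
    ext z
    simp only [PCMPaper.thetaS, alphaS, betaS, Set.mem_union, Set.mem_ofPred_eq,
      Set.mem_insert_iff, Set.mem_singleton_iff, Set.mem_empty_iff_false, iff_false] at hx ⊢
    rcases hx with rfl | rfl <;> rintro (⟨rfl | rfl, h⟩ | ⟨rfl | rfl, h⟩) <;>
      first | exact lt_irrefl _ h | exact hab h | exact hba h
  | succ n => exact hX.2.2 x hx

theorem IsSurfaceAux.index_unique {m n : ℕ} {X : Set α} (hm : IsSurfaceAux m X)
    (hn : IsSurfaceAux n X) : m = n := by
  induction m generalizing n X with
  | zero =>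
    obtain rfl : X = ∅ := hm
    exact (isSurfaceAux_empty_iff.1 hn).symm
  | succ m ih =>
    obtain ⟨x, hx⟩ := hm.nonempty
    cases n with
    | zero =>
      obtain rfl : X = ∅ := hn
      exact hx.elim
    | succ n => rw [ih (hm.thetaS hx) (hn.thetaS hx)]

theorem thetaS_union_left {X Y : Set α} (hXY : ∀ x ∈ X, ∀ y ∈ Y, x < y) {x : α} (hx : x ∈ X) :
    thetaS (X ∪ Y) x = thetaS X x ∪ Y := by
  ext z
  simp only [thetaS, alphaS, betaS, Set.mem_union, Set.mem_ofPred_eq]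
  have := hXY x hx z
  tauto

theorem thetaS_union_right {X Y : Set α} (hXY : ∀ x ∈ X, ∀ y ∈ Y, x < y) {y : α} (hy : y ∈ Y) :
    thetaS (X ∪ Y) y = X ∪ thetaS Y y := by
  ext z
  simp only [thetaS, alphaS, betaS, Set.mem_union, Set.mem_ofPred_eq]
  have := fun hz => hXY z hz y hy
  tauto

theorem thetaS_subset (X : Set α) (x : α) : thetaS X x ⊆ X := by
  rintro z (hz | hz) <;> exact hz.1

/-- The ordinal sum of two surfaces is a surface. -/
theorem IsSurfaceAux.union {a b : ℕ} {X Y : Set α} (hXY : ∀ x ∈ X, ∀ y ∈ Y, x < y)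
    (hX : IsSurfaceAux a X) (hY : IsSurfaceAux b Y) : IsSurfaceAux (a + b) (X ∪ Y) := by
  induction hk : a + b generalizing a b X Y with
  | zero =>
    obtain ⟨rfl, rfl⟩ : a = 0 ∧ b = 0 := by omega
    obtain rfl : X = ∅ := hX
    obtain rfl : Y = ∅ := hY
    simp [IsSurfaceAux]
  | succ k ih =>
    cases a with
    | zero =>
      obtain rfl : X = ∅ := hX
      obtain rfl : b = k + 1 := by omega
      rwa [Set.empty_union]
    | succ a =>
      cases b with
      | zero =>
        obtain rfl : Y = ∅ := hY
        obtain rfl : a = k := by omega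
        rwa [Set.union_empty]
      | succ b =>
        obtain ⟨k, rfl⟩ : ∃ l, k = l + 1 := ⟨a + b, by omega⟩
        obtain ⟨x₀, hx₀⟩ := hX.nonempty
        obtain ⟨y₀, hy₀⟩ := hY.nonempty
        have up : ∀ x ∈ X, ∀ y ∈ Y, rel (X ∪ Y) x y := fun x hx y hy =>
          ⟨.inl hx, .inr hy, (hXY x hx y hy).ne, .inl (hXY x hx y hy)⟩
        have down : ∀ x ∈ X, ∀ y ∈ Y, rel (X ∪ Y) y x := fun x hx y hy =>
          ⟨.inr hy, .inl hx, (hXY x hx y hy).ne', .inr (hXY x hx y hy)⟩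
        refine ⟨⟨x₀, .inl hx₀⟩, ?_, ?_⟩
        · rintro u (hu | hu) v (hv | hv)
          · exact (Relation.ReflTransGen.single (up u hu y₀ hy₀)).tail (down v hv y₀ hy₀)
          · exact .single (up u hu v hv)
          · exact .single (down v hv u hu)
          · exact (Relation.ReflTransGen.single (down x₀ hx₀ u hu)).tail (up x₀ hx₀ v hv)
        · rintro z (hz | hz)
          · rw [thetaS_union_left hXY hz]
            exact ih (fun x hx => hXY x (thetaS_subset X z hx)) (hX.thetaS hz) hY (by omega)
          · rw [thetaS_union_right hXY hz]
            exact ih (fun x hx y hy => hXY x hx y (thetaS_subset Y z hy)) hX (hY.thetaS hz)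
              (by omega)

/-- If an ordinal sum is a surface, then so are both summands. -/
theorem IsSurfaceAux.of_union {m : ℕ} {X Y : Set α} (hXY : ∀ x ∈ X, ∀ y ∈ Y, x < y)
    (h : IsSurfaceAux m (X ∪ Y)) :
    ∃ a b, a + b = m ∧ IsSurfaceAux a X ∧ IsSurfaceAux b Y := by
  induction m generalizing X Y with
  | zero =>
    obtain ⟨rfl, rfl⟩ := Set.union_empty_iff.1 (show X ∪ Y = ∅ from h)
    exact ⟨0, 0, rfl, rfl, rfl⟩
  | succ m ih =>
    rcases X.eq_empty_or_nonempty with rfl | ⟨x, hx⟩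
    · exact ⟨0, m + 1, by omega, rfl, by rwa [Set.empty_union] at h⟩
    rcases Y.eq_empty_or_nonempty with rfl | ⟨y, hy⟩
    · exact ⟨m + 1, 0, by omega, by rwa [Set.union_empty] at h, rfl⟩
    have h₁ := h.thetaS (.inl hx)
    have h₂ := h.thetaS (.inr hy)
    rw [thetaS_union_left hXY hx] at h₁
    rw [thetaS_union_right hXY hy] at h₂
    obtain ⟨a', b, hab, hXx, hY⟩ := ih (fun z hz => hXY z (thetaS_subset X x hz)) h₁
    obtain ⟨a, -, -, hX, -⟩ := ih (fun z hz w hw => hXY z hz w (thetaS_subset Y y hw)) h₂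
    cases a with
    | zero =>
      obtain rfl : X = ∅ := hX
      exact hx.elim
    | succ a =>
      have := (hX.thetaS hx).index_unique hXx
      exact ⟨a + 1, b, by omega, hX, hY⟩

theorem thetaS_Ioo {s t x : α} (hx : x ∈ Set.Ioo s t) :
    thetaS (Set.Ioo s t) x = Set.Ioo s x ∪ Set.Ioo x t := by
  ext z
  simp only [thetaS, alphaS, betaS, Set.mem_union, Set.mem_ofPred_eq, Set.mem_Ioo]
  have h₁ : z < x → z < t := fun h => h.trans hx.2
  have h₂ : x < z → s < z := fun h => hx.1.trans h
  tauto

theorem isConnected_Ioo_finset {V : Type*} [DecidableEq V] {s t : Finset V}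
    (hc : s.card + 2 < t.card) : IsConnected (Set.Ioo s t) := by
  have atom : ∀ a ∈ t, a ∉ s → insert a s ∈ Set.Ioo s t → ∀ b ∈ t, b ∉ s →
      insert b s ∈ Set.Ioo s t →
      Relation.ReflTransGen (rel (Set.Ioo s t)) (insert a s) (insert b s) := by
    intro a hat ha hai b hbt hb hbi
    by_cases hab : a = b
    · rw [hab]
    have h₁ : insert a s < insert a (insert b s) := by
      rw [Finset.insert_comm]
      exact Finset.ssubset_insert (by simp [hb, Ne.symm hab])
    have h₂ : insert b s < insert a (insert b s) := Finset.ssubset_insert (by simp [ha, hab])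
    have hm : insert a (insert b s) ∈ Set.Ioo s t := by
      refine ⟨hai.1.trans h₁, Finset.ssubset_of_subset_of_ssubset subset_rfl
        (Finset.ssubset_iff_subset_ne.2 ⟨?_, ?_⟩)⟩
      · exact Finset.insert_subset hat hbi.2.le
      · rintro rfl
        have := Finset.card_insert_le a (insert b s)
        have := Finset.card_insert_le b s
        omega
    exact (Relation.ReflTransGen.single ⟨hai, hm, h₁.ne, .inl h₁⟩).tail ⟨hm, hbi, h₂.ne', .inr h₂⟩
  have below : ∀ x ∈ Set.Ioo s t, ∃ a ∈ t, a ∉ s ∧ insert a s ∈ Set.Ioo s t ∧ insert a s ≤ x := by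
    intro x hx
    obtain ⟨a, hax, has⟩ := Finset.exists_of_ssubset hx.1
    have hle : insert a s ≤ x := Finset.insert_subset hax hx.1.le
    exact ⟨a, hx.2.le hax, has, ⟨Finset.ssubset_insert has, hle.trans_lt hx.2⟩, hle⟩
  intro x hx y hy
  obtain ⟨a, hat, ha, hai, hax⟩ := below x hx
  obtain ⟨b, hbt, hb, hbi, hby⟩ := below y hy
  have h₁ : Relation.ReflTransGen (rel (Set.Ioo s t)) x (insert a s) := by
    rcases hax.eq_or_lt with h | h
    · rw [h]
    · exact .single ⟨hx, hai, h.ne', .inr h⟩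
  have h₂ : Relation.ReflTransGen (rel (Set.Ioo s t)) (insert b s) y := by
    rcases hby.eq_or_lt with h | h
    · rw [h]
    · exact .single ⟨hbi, hy, h.ne, .inl h⟩
  exact (h₁.trans (atom a hat ha hai b hbt hb hbi)).trans h₂

/-- Open intervals in a Boolean lattice of finite sets are spheres. -/
theorem isSurfaceAux_Ioo_finset {V : Type*} [DecidableEq V] {k : ℕ} {s t : Finset V} (hst : s ⊆ t)
    (hk : t.card = s.card + k + 1) : IsSurfaceAux k (Set.Ioo s t) := by
  induction k using Nat.strong_induction_on generalizing s t with
  | _ k ih =>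
  match k with
  | 0 =>
    change _ = ∅
    ext z
    simp only [Set.mem_Ioo, Set.mem_empty_iff_false, iff_false]
    rintro ⟨h₁, h₂⟩
    have := Finset.card_lt_card h₁
    have := Finset.card_lt_card h₂
    omega
  | 1 =>
    have hd : (t \ s).card = 2 := by rw [Finset.card_sdiff_of_subset hst]; omega
    obtain ⟨a, b, hab, hd⟩ := Finset.card_eq_two.1 hd
    have ha : a ∈ t \ s := by simp [hd]
    have hb : b ∈ t \ s := by simp [hd]
    rw [Finset.mem_sdiff] at ha hb
    have hca := Finset.card_insert_of_notMem ha.2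
    have hcb := Finset.card_insert_of_notMem hb.2
    refine ⟨insert a s, insert b s, ?_, ?_, ?_, ?_⟩
    · intro h
      have : a ∈ insert b s := h ▸ Finset.mem_insert_self a s
      simp [hab, ha.2] at this
    · intro h
      have := Finset.card_lt_card h
      omega
    · intro h
      have := Finset.card_lt_card h
      omega
    · ext z
      simp only [Set.mem_Ioo, Set.mem_insert_iff, Set.mem_singleton_iff]
      constructor
      · rintro ⟨h₁, h₂⟩
        have c₁ := Finset.card_lt_card h₁
        have c₂ := Finset.card_lt_card h₂
        obtain ⟨e, hez, hes⟩ := Finset.exists_of_ssubset h₁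
        have hz : insert e s = z := by
          refine Finset.eq_of_subset_of_card_le (Finset.insert_subset hez h₁.le) ?_
          rw [Finset.card_insert_of_notMem hes]
          omega
        have he : e ∈ t \ s := Finset.mem_sdiff.2 ⟨h₂.le hez, hes⟩
        rw [hd] at he
        simp only [Finset.mem_insert, Finset.mem_singleton] at he
        rcases he with rfl | rfl
        · exact .inl hz.symm
        · exact .inr hz.symm
      · rintro (rfl | rfl)
        · refine ⟨Finset.ssubset_insert ha.2, Finset.ssubset_iff_subset_ne.2
            ⟨Finset.insert_subset ha.1 hst, ?_⟩⟩
          rintro rfl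
          omega
        · refine ⟨Finset.ssubset_insert hb.2, Finset.ssubset_iff_subset_ne.2
            ⟨Finset.insert_subset hb.1 hst, ?_⟩⟩
          rintro rfl
          omega
  | k + 2 =>
    refine ⟨?_, isConnected_Ioo_finset (by omega), ?_⟩
    · obtain ⟨u, hsu, hut, hu⟩ :=
        Finset.exists_subsuperset_card_eq hst (n := s.card + 1) (by omega) (by omega)
      refine ⟨u, Finset.ssubset_iff_subset_ne.2 ⟨hsu, ?_⟩,
        Finset.ssubset_iff_subset_ne.2 ⟨hut, ?_⟩⟩ <;> rintro rfl <;> omega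
    · intro x hx
      have c₁ := Finset.card_lt_card hx.1
      have c₂ := Finset.card_lt_card hx.2
      rw [thetaS_Ioo hx]
      have := IsSurfaceAux.union (fun u hu v hv => hu.2.trans hv.1)
        (ih (x.card - s.card - 1) (by omega) hx.1.le (by omega))
        (ih (t.card - x.card - 1) (by omega) hx.2.le (by omega))
      rwa [show x.card - s.card - 1 + (t.card - x.card - 1) = k + 1 by omega] at this

theorem exists_ltSeries_finset {V : Type*} [DecidableEq V] {k : ℕ} {s t : Finset V} (hst : s ⊆ t)
    (hk : t.card = s.card + k + 1) :
    ∃ p : LTSeries (Finset V), p.length = k ∧ (∀ i, s < p i ∧ p i ≤ t) ∧ p.last = t := by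
  induction k generalizing t with
  | zero =>
    refine ⟨RelSeries.singleton _ t, rfl, fun i => ⟨?_, le_rfl⟩, rfl⟩
    exact Finset.ssubset_iff_subset_ne.2 ⟨hst, by rintro rfl; omega⟩
  | succ k ih =>
    obtain ⟨u, hsu, hut, hu⟩ :=
      Finset.exists_subsuperset_card_eq hst (n := s.card + k + 1) (by omega) (by omega)
    obtain ⟨p, rfl, hp, hl⟩ := ih hsu hu
    have hlt : u < t := Finset.ssubset_iff_subset_ne.2 ⟨hut, by rintro rfl; omega⟩
    have hlast : p.last < t := hl ▸ hlt
    refine ⟨p.snoc t hlast, rfl, fun i => ?_, RelSeries.last_snoc ..⟩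
    induction i using Fin.lastCases with
    | last =>
      have := RelSeries.last_snoc' p t hlast
      exact ⟨(hsu.trans_lt hlt).trans_eq this.symm, this.le⟩
    | cast i =>
      have := RelSeries.snoc_castSucc p t hlast i
      exact ⟨(hp i).1.trans_eq this.symm, this.trans_le ((hp i).2.trans hut)⟩

/-- In a down-closed family of finite sets, the rank above `s` counts the added points. -/
theorem rank_betaS {V : Type*} [DecidableEq V] {X : Set (Finset V)}
    (hX : ∀ h ∈ X, ∀ h' : Finset V, h'.Nonempty → h' ⊆ h → h' ∈ X) {s x : Finset V}
    (hx : x ∈ betaS X s) : rank (betaS X s) x = x.card - s.card - 1 := by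
  have hc := Finset.card_lt_card hx.2
  refine IsGreatest.csSup_eq ⟨?_, ?_⟩
  · obtain ⟨p, hp, hps, hpl⟩ := exists_ltSeries_finset (k := x.card - s.card - 1) hx.2.le (by omega)
    rw [← hp]
    refine ⟨p, p.strictMono, fun i => ⟨hX x hx.1 _ ?_ (hps i).2, (hps i).1⟩, hpl⟩
    exact Finset.card_pos.1 ((Nat.zero_le _).trans_lt (Finset.card_lt_card (hps i).1))
  · rintro n ⟨c, hcm, hcX, rfl⟩
    have key : ∀ i : Fin (n + 1), s.card + 1 + i ≤ (c i).card := by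
      intro i
      induction i using Fin.induction with
      | zero => simpa using Finset.card_lt_card (hcX 0).2
      | succ i ih =>
        have := Finset.card_lt_card (hcm i.castSucc_lt_succ)
        simp only [Fin.val_castSucc, Fin.val_succ] at ih ⊢
        omega
    have := key (Fin.last n)
    simp only [Fin.val_last] at this
    omega

theorem rankSet_nonempty {X : Set α} (hX : X.Nonempty) :
    rankSet X = ((sSup (rank X '' X) : ℕ) : ℤ) := by
  simp [rankSet, hX.ne_empty]

theorem IsSimplicialComplex.betaS_empty {V : Type*} [DecidableEq V] {X : Set (Finset V)}
    (hX : IsSimplicialComplex X) : betaS X ∅ = X := by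
  ext z
  exact ⟨fun h => h.1, fun h => ⟨h, Finset.empty_ssubset.2 (hX.2.1 z h)⟩⟩

theorem IsSimplicialComplex.card_le_rankSet {V : Type*} [DecidableEq V] {X : Set (Finset V)}
    (hX : IsSimplicialComplex X) {x : Finset V} (hx : x ∈ X) : (x.card : ℤ) ≤ rankSet X + 1 := by
  have hr := rank_betaS (s := ∅) hX.2.2.1 (x := x) (by rwa [hX.betaS_empty])
  rw [hX.betaS_empty, Finset.card_empty] at hr
  have := le_csSup (hX.1.image (rank X)).bddAbove (Set.mem_image_of_mem _ hx)
  rw [rankSet_nonempty ⟨x, hx⟩]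
  omega

theorem IsSimplicialComplex.alphaS_eq_Ioo {V : Type*} [DecidableEq V] {X : Set (Finset V)}
    (hX : IsSimplicialComplex X) {h : Finset V} (hh : h ∈ X) : alphaS X h = Set.Ioo ∅ h := by
  ext z
  exact ⟨fun hz => ⟨Finset.empty_ssubset.2 (hX.2.1 z hz.1), hz.2⟩,
    fun hz => ⟨hX.2.2.1 h hh z (Finset.empty_ssubset.1 hz.1) hz.2.le, hz.2⟩⟩

theorem IsSimplicialComplex.isSurfaceAux_alphaS {V : Type*} [DecidableEq V] {X : Set (Finset V)}
    (hX : IsSimplicialComplex X) {h : Finset V} (hh : h ∈ X) :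
    IsSurfaceAux (h.card - 1) (alphaS X h) := by
  have := (hX.2.1 h hh).card_pos
  rw [hX.alphaS_eq_Ioo hh]
  exact isSurfaceAux_Ioo_finset (Finset.empty_subset h) (by rw [Finset.card_empty]; omega)

theorem thetaS_thetaS_upper {X : Set α} {x y : α} (hxy : x < y) :
    thetaS (thetaS X x) y = thetaS (alphaS X y) x ∪ betaS X y := by
  ext z
  simp only [thetaS, alphaS, betaS, Set.mem_union, Set.mem_ofPred_eq]
  have h₁ : z < x → z < y := fun h => h.trans hxy
  have h₂ : y < z → x < z := fun h => hxy.trans h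
  tauto

theorem thetaS_thetaS_lower {X : Set α} {x y : α} (hxy : x < y) :
    thetaS (thetaS X y) x = alphaS X x ∪ thetaS (betaS X x) y := by
  ext z
  simp only [thetaS, alphaS, betaS, Set.mem_union, Set.mem_ofPred_eq]
  have h₁ : z < x → z < y := fun h => h.trans hxy
  have h₂ : y < z → x < z := fun h => hxy.trans h
  tauto

theorem IsSimplicialComplex.isSurfaceAux_thetaS_of_lt {V : Type*} [DecidableEq V]
    {X : Set (Finset V)} (hX : IsSimplicialComplex X) {x y : Finset V} (hx : x ∈ X) (hy : y ∈ X)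
    (hxy : x < y) {m : ℕ} (h : IsSurfaceAux m (thetaS X x)) : IsSurfaceAux m (thetaS X y) := by
  have hyx : y ∈ thetaS X x := .inr ⟨hy, hxy⟩
  cases m with
  | zero =>
    rw [show thetaS X x = ∅ from h] at hyx
    exact hyx.elim
  | succ m =>
    have h' := h.thetaS hyx
    rw [thetaS_thetaS_upper hxy] at h'
    obtain ⟨a, b, hab, ha, hb⟩ :=
      h'.of_union fun u hu v hv => (thetaS_subset _ _ hu).2.trans hv.2
    have hα := hX.isSurfaceAux_alphaS hy
    have := Finset.card_lt_card hxy
    have := (hX.2.1 x hx).card_pos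
    obtain ⟨p, hp⟩ : ∃ p, y.card - 1 = p + 1 := ⟨y.card - 2, by omega⟩
    rw [hp] at hα
    have := (hα.thetaS ⟨hx, hxy⟩).index_unique ha
    have := IsSurfaceAux.union (fun u hu v hv => hu.2.trans hv.2) hα hb
    rwa [show p + 1 + b = m + 1 by omega] at this

/-- A maximal simplex above one with spherical neighborhood has the expected dimension. -/
theorem IsSimplicialComplex.exists_card_eq_of_isSurfaceAux {V : Type*} [DecidableEq V]
    {X : Set (Finset V)} (hX : IsSimplicialComplex X) {g : Finset V} (hg : g ∈ X) {m : ℕ}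
    (h : IsSurfaceAux m (thetaS X g)) : ∃ x ∈ X, g ≤ x ∧ x.card = m + 1 := by
  obtain ⟨x, hgx, hx⟩ := hX.1.exists_le_maximal hg
  have hs : IsSurfaceAux m (thetaS X x) := by
    rcases hgx.eq_or_lt with rfl | hlt
    · exact h
    · exact hX.isSurfaceAux_thetaS_of_lt hg hx.prop hlt h
  have hβ : betaS X x = ∅ := Set.eq_empty_iff_forall_notMem.2 fun z hz => hx.not_gt hz.1 hz.2
  rw [thetaS, hβ, Set.union_empty] at hs
  have := hs.index_unique (hX.isSurfaceAux_alphaS hx.prop)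
  have := (hX.2.1 x hx.prop).card_pos
  exact ⟨x, hx.prop, hgx, by omega⟩

/-- If `X` is at the same time a simplicial complex and an `n`-PCM
with `n ≥ 1`, then for every `h ∈ ΔX`: (1) `α□_X(h) ⊆ ΔX`, and
(2) `Δ(β□_X(h)) ⊆ ΔX`. -/
theorem statement_7 {V : Type*} [DecidableEq V] (X : Set (Finset V)) (n : ℤ) (hn : 1 ≤ n)
    (hsc : IsSimplicialComplex X) (hpcm : IsPCM n X)
    (h : Finset V) (hh : h ∈ border X) :
    alphaS X h ⊆ border X ∧ border (betaS X h) ⊆ border X := by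
  constructor
  · intro x hx
    refine ⟨hx.1, fun ⟨m, hm, hs⟩ => hh.2 ⟨m, hm, ?_⟩⟩
    exact hsc.isSurfaceAux_thetaS_of_lt hx.1 hh.1 hx.2 hs
  · rintro g ⟨hg, hgb⟩
    refine ⟨hg.1, fun ⟨m, hm, hs⟩ => hgb ?_⟩
    have hmem : h ∈ thetaS X g := .inl ⟨hh.1, hg.2⟩
    cases m with
    | zero =>
      rw [show thetaS X g = ∅ from hs] at hmem
      exact hmem.elim
    | succ m =>
      have h' := hs.thetaS hmem
      rw [thetaS_thetaS_lower hg.2] at h'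
      obtain ⟨a, b, hab, ha, hb⟩ :=
        h'.of_union fun u hu v hv => hu.2.trans (thetaS_subset _ _ hv).2
      have hpos := (hsc.2.1 h hh.1).card_pos
      have haeq := ha.index_unique (hsc.isSurfaceAux_alphaS hh.1)
      obtain ⟨x, hx, hgx, hxc⟩ := hsc.exists_card_eq_of_isSurfaceAux hg.1 hs
      have hxβ : x ∈ betaS X h := ⟨hx, hg.2.trans_le hgx⟩
      have hsup : sSup (rank (betaS X h) '' betaS X h) = b := by
        refine IsGreatest.csSup_eq ⟨⟨x, hxβ, ?_⟩, ?_⟩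
        · rw [rank_betaS hsc.2.2.1 hxβ]
          omega
        · rintro _ ⟨y, hy, rfl⟩
          rw [rank_betaS hsc.2.2.1 hy]
          have := hsc.card_le_rankSet hy.1
          omega
      refine ⟨b, ?_, hb⟩
      rw [rankSet_nonempty ⟨x, hxβ⟩, hsup]
      omega

end PCMPaper
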